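/- For every natural number k, the pair {ω·2^k, ω*·2^k} is strictly below the pair {ω·2^{k+1}, ω*·2^{k+1}} in the ordering induced by computable embeddings. -/

import Mathlib

/-- A finite linear order: a finite piece of an atomic diagram in the language `{<}`,
with domain a finite set of naturals. -/
structure FinLO where
  dom : Finset ℕ
  rel : ℕ → ℕ → Prop
  irrefl : ∀ x ∈ dom, ¬ rel x x
  trans : ∀ x ∈ dom, ∀ y ∈ dom, ∀ z ∈ dom, rel x y → rel y z → rel x z
  total : ∀ x ∈ dom, ∀ y ∈ dom, x ≠ y → rel x y ∨ rel y x

/-- `β` extends `α` as a finite atomic diagram. -/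
def FinLO.Ext (α β : FinLO) : Prop :=
  α.dom ⊆ β.dom ∧ ∀ x ∈ α.dom, ∀ y ∈ α.dom, (α.rel x y ↔ β.rel x y)

/-- An enumeration operator on finite linear orders: it monotonically enumerates
membership facts `x ∈ Γ(α)`, positive atomic facts `x < y` and negative atomic
facts `¬ x < y`. -/
structure EnumOp where
  mem : FinLO → Set ℕ
  pos : FinLO → Set (ℕ × ℕ)
  neg : FinLO → Set (ℕ × ℕ)
  mono_mem : ∀ {α β : FinLO}, α.Ext β → mem α ⊆ mem β
  mono_pos : ∀ {α β : FinLO}, α.Ext β → pos α ⊆ pos β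
  mono_neg : ∀ {α β : FinLO}, α.Ext β → neg α ⊆ neg β

/-- The outputs of `Γ` are consistent with being part of the atomic diagram of
a linear order. -/
def EnumOp.Consistent (Γ : EnumOp) : Prop :=
  ∀ α : FinLO, (∀ x : ℕ, (x, x) ∉ Γ.pos α) ∧
    (∀ x y : ℕ, ¬ ((x, y) ∈ Γ.pos α ∧ (y, x) ∈ Γ.pos α)) ∧
    (∀ x y : ℕ, ¬ ((x, y) ∈ Γ.pos α ∧ (x, y) ∈ Γ.neg α))

/-- `α ⊩_Γ x < y` : both `x` and `y` occur in `Γ(α)` and no extension `β ⊇ α`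
has `Γ(β) ⊨ ¬ (x < y)`. -/
def EnumOp.Forces (Γ : EnumOp) (α : FinLO) (x y : ℕ) : Prop :=
  x ∈ Γ.mem α ∧ y ∈ Γ.mem α ∧ ∀ β : FinLO, α.Ext β → (x, y) ∉ Γ.neg β

/-- Every pair of distinct elements occurring in `Γ(α)` is decided by some
extension of `α`. -/
def EnumOp.Decides (Γ : EnumOp) : Prop :=
  ∀ α : FinLO, ∀ x ∈ Γ.mem α, ∀ y ∈ Γ.mem α, x ≠ y →
    ∃ β : FinLO, α.Ext β ∧ ((x, y) ∈ Γ.pos β ∨ (x, y) ∈ Γ.neg β)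

/-- A (possibly infinite) diagram in the language `{<}` with domain a set of naturals. -/
structure LinDiag where
  dom : Set ℕ
  rel : ℕ → ℕ → Prop

/-- `α` is a finite subdiagram of `L`. -/
def FinLO.SubDiag (α : FinLO) (L : LinDiag) : Prop :=
  ↑α.dom ⊆ L.dom ∧ ∀ x ∈ α.dom, ∀ y ∈ α.dom, (α.rel x y ↔ L.rel x y)

/-- Membership facts enumerated by `Γ` on the infinite diagram `L`. -/
def EnumOp.memD (Γ : EnumOp) (L : LinDiag) : Set ℕ :=
  {x | ∃ α : FinLO, α.SubDiag L ∧ x ∈ Γ.mem α}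

/-- Positive facts `x < y` enumerated by `Γ` on the infinite diagram `L`. -/
def EnumOp.posD (Γ : EnumOp) (L : LinDiag) : Set (ℕ × ℕ) :=
  {p | ∃ α : FinLO, α.SubDiag L ∧ p ∈ Γ.pos α}

/-- Negative facts `¬ x < y` enumerated by `Γ` on the infinite diagram `L`. -/
def EnumOp.negD (Γ : EnumOp) (L : LinDiag) : Set (ℕ × ℕ) :=
  {p | ∃ α : FinLO, α.SubDiag L ∧ p ∈ Γ.neg α}

/-- `L` is (the atomic diagram of) a copy of the linear order `τ`. -/
def IsCopy (τ : Type) [LinearOrder τ] (L : LinDiag) : Prop :=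
  ∃ f : τ → ℕ, Function.Injective f ∧ Set.range f = L.dom ∧
    ∀ i j : τ, (L.rel (f i) (f j) ↔ i < j)

/-- The output of `Γ` on `L` is (the atomic diagram of) a copy of the linear
order `σ`. -/
def EnumOp.OutCopy (Γ : EnumOp) (σ : Type) [LinearOrder σ] (L : LinDiag) : Prop :=
  ∃ g : σ → ℕ, Function.Injective g ∧ Γ.memD L = Set.range g ∧
    (∀ a b : σ, ((g a, g b) ∈ Γ.posD L ↔ a < b)) ∧
    (∀ a b : σ, ((g a, g b) ∈ Γ.negD L ↔ ¬ a < b))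

/-- `Γ` is a computable embedding of the pair `{A, B}` into the pair `{C, D}`:
it maps every copy of `A` to a copy of `C` and every copy of `B` to a copy of `D`. -/
def EnumOp.Embeds (Γ : EnumOp) (A B C D : Type) [LinearOrder A] [LinearOrder B]
    [LinearOrder C] [LinearOrder D] : Prop :=
  (∀ L : LinDiag, IsCopy A L → Γ.OutCopy C L) ∧
  (∀ L : LinDiag, IsCopy B L → Γ.OutCopy D L)

/-- `{A, B} ≤_c {C, D}` : there is a computable embedding (an enumeration
operator) of the pair `{A, B}` into the pair `{C, D}`. -/
def PairLE (A B C D : Type) [LinearOrder A] [LinearOrder B] [LinearOrder C]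
    [LinearOrder D] : Prop :=
  ∃ Γ : EnumOp, Γ.Embeds A B C D

/-- `L` is a strict linear order on its domain. -/
structure LinDiag.IsStrictLin (L : LinDiag) : Prop where
  irrefl : ∀ x ∈ L.dom, ¬ L.rel x x
  trans : ∀ x ∈ L.dom, ∀ y ∈ L.dom, ∀ z ∈ L.dom, L.rel x y → L.rel y z → L.rel x z
  total : ∀ x ∈ L.dom, ∀ y ∈ L.dom, x ≠ y → L.rel x y ∨ L.rel y x

theorem IsCopy.isStrictLin {τ : Type} [LinearOrder τ] {L : LinDiag} (h : IsCopy τ L) :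
    L.IsStrictLin := by
  obtain ⟨f, -, hr, hrel⟩ := h
  refine ⟨?_, ?_, ?_⟩ <;> rw [← hr]
  · rintro _ ⟨a, rfl⟩
    simp [hrel]
  · rintro _ ⟨a, rfl⟩ _ ⟨b, rfl⟩ _ ⟨c, rfl⟩
    simpa only [hrel] using lt_trans
  · rintro _ ⟨a, rfl⟩ _ ⟨b, rfl⟩ hne
    simpa only [hrel] using lt_or_gt_of_ne (fun h => hne (congrArg f h))

/-- The finite restriction of a linear diagram. -/
def LinDiag.IsStrictLin.restrict {L : LinDiag} (hL : L.IsStrictLin) (S : Finset ℕ)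
    (hS : ↑S ⊆ L.dom) : FinLO where
  dom := S
  rel := L.rel
  irrefl x hx := hL.irrefl x (hS hx)
  trans x hx y hy z hz := hL.trans x (hS hx) y (hS hy) z (hS hz)
  total x hx y hy := hL.total x (hS hx) y (hS hy)

theorem LinDiag.IsStrictLin.restrict_subDiag {L : LinDiag} (hL : L.IsStrictLin) (S : Finset ℕ)
    (hS : ↑S ⊆ L.dom) : (hL.restrict S hS).SubDiag L :=
  ⟨hS, fun _ _ _ _ => Iff.rfl⟩

theorem FinLO.SubDiag.ext_restrict {L : LinDiag} {α : FinLO} (hα : α.SubDiag L)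
    (hL : L.IsStrictLin) (S : Finset ℕ) (hS : ↑S ⊆ L.dom) (h : α.dom ⊆ S) :
    α.Ext (hL.restrict S hS) :=
  ⟨h, hα.2⟩

/-- Any two finite subdiagrams of a linear diagram have a common finite extension inside it. -/
theorem FinLO.SubDiag.exists_common_ext {L : LinDiag} (hL : L.IsStrictLin) {α β : FinLO}
    (hα : α.SubDiag L) (hβ : β.SubDiag L) :
    ∃ γ : FinLO, γ.SubDiag L ∧ α.Ext γ ∧ β.Ext γ := by
  have hS : ((α.dom ∪ β.dom : Finset ℕ) : Set ℕ) ⊆ L.dom := by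
    simpa using ⟨hα.1, hβ.1⟩
  exact ⟨hL.restrict _ hS, hL.restrict_subDiag _ hS,
    hα.ext_restrict hL _ hS Finset.subset_union_left,
    hβ.ext_restrict hL _ hS Finset.subset_union_right⟩

/-! ### Outputs of operators on copies -/

theorem EnumOp.OutCopy.pos_or_neg {Γ : EnumOp} {σ : Type} [LinearOrder σ] {L : LinDiag}
    (h : Γ.OutCopy σ L) {x y : ℕ} (hx : x ∈ Γ.memD L) (hy : y ∈ Γ.memD L) :
    (x, y) ∈ Γ.posD L ∨ (x, y) ∈ Γ.negD L := by
  obtain ⟨g, -, hmem, hpos, hneg⟩ := h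
  rw [hmem] at hx hy
  obtain ⟨a, rfl⟩ := hx
  obtain ⟨b, rfl⟩ := hy
  rw [hpos, hneg]
  exact em _

theorem EnumOp.OutCopy.not_pos_and_neg {Γ : EnumOp} {σ : Type} [LinearOrder σ] {L : LinDiag}
    (h : Γ.OutCopy σ L) {x y : ℕ} (hx : x ∈ Γ.memD L) (hy : y ∈ Γ.memD L)
    (hp : (x, y) ∈ Γ.posD L) : (x, y) ∉ Γ.negD L := by
  obtain ⟨g, -, hmem, hpos, hneg⟩ := h
  rw [hmem] at hx hy
  obtain ⟨a, rfl⟩ := hx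
  obtain ⟨b, rfl⟩ := hy
  rw [hpos] at hp
  rw [hneg]
  exact not_not.2 hp

/-! ### Doubling a linear order -/

/-- The order of `R + R`, with `2 * x` and `2 * x + 1` standing for the two copies of `x`. -/
def doubleRel (R : ℕ → ℕ → Prop) (z w : ℕ) : Prop :=
  z % 2 < w % 2 ∨ z % 2 = w % 2 ∧ R (z / 2) (w / 2)

/-- The enumeration operator `L ↦ L + L`. -/
def doubleOp : EnumOp where
  mem α := {z | z / 2 ∈ α.dom}
  pos α := {p | p.1 / 2 ∈ α.dom ∧ p.2 / 2 ∈ α.dom ∧ doubleRel α.rel p.1 p.2}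
  neg α := {p | p.1 / 2 ∈ α.dom ∧ p.2 / 2 ∈ α.dom ∧ ¬ doubleRel α.rel p.1 p.2}
  mono_mem h _ hz := h.1 hz
  mono_pos := by
    rintro α β h p ⟨h1, h2, h3⟩
    refine ⟨h.1 h1, h.1 h2, ?_⟩
    rwa [doubleRel, ← h.2 _ h1 _ h2]
  mono_neg := by
    rintro α β h p ⟨h1, h2, h3⟩
    refine ⟨h.1 h1, h.1 h2, ?_⟩
    rwa [doubleRel, ← h.2 _ h1 _ h2]

theorem doubleOp_outCopy {τ σ : Type} [LinearOrder τ] [LinearOrder σ] {L : LinDiag}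
    (hL : IsCopy τ L) (b : σ → ℕ) (h : σ → τ) (hb : ∀ s, b s < 2)
    (hsurj : ∀ i < 2, ∀ a : τ, ∃ s, b s = i ∧ h s = a)
    (hlt : ∀ s s' : σ, s < s' ↔ b s < b s' ∨ b s = b s' ∧ h s < h s') :
    doubleOp.OutCopy σ L := by
  have hlin := hL.isStrictLin
  obtain ⟨f, hf, hr, hrel⟩ := hL
  have hmod (s : σ) : (2 * f (h s) + b s) % 2 = b s := by have := hb s; omega
  have hdiv (s : σ) : (2 * f (h s) + b s) / 2 = f (h s) := by have := hb s; omega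
  have hdom (s : σ) : f (h s) ∈ L.dom := hr ▸ Set.mem_range_self _
  have hdouble (s s' : σ) :
      doubleRel L.rel (2 * f (h s) + b s) (2 * f (h s') + b s') ↔ s < s' := by
    rw [doubleRel, hmod, hmod, hdiv, hdiv, hrel, hlt]
  have hS (s s' : σ) : (({f (h s), f (h s')} : Finset ℕ) : Set ℕ) ⊆ L.dom := by
    intro x hx
    simp only [Finset.coe_insert, Finset.coe_singleton, Set.mem_insert_iff,
      Set.mem_singleton_iff] at hx
    rcases hx with rfl | rfl <;> exact hdom _
  refine ⟨fun s => 2 * f (h s) + b s, ?_, ?_, ?_, ?_⟩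
  · intro s s' hss
    have h1 : b s = b s' := by rw [← hmod s, ← hmod s']; exact congrArg (· % 2) hss
    have h2 : h s = h s' := hf (by rw [← hdiv s, ← hdiv s']; exact congrArg (· / 2) hss)
    by_contra hne
    rcases lt_or_gt_of_ne hne with hl | hl <;> rw [hlt] at hl <;> simp [h1, h2] at hl
  · ext z
    constructor
    · rintro ⟨α, hα, hz⟩
      have hz' : z / 2 ∈ L.dom := hα.1 hz
      rw [← hr] at hz'
      obtain ⟨a, ha⟩ := hz'
      obtain ⟨s, hs1, hs2⟩ := hsurj (z % 2) (by omega) a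
      refine ⟨s, ?_⟩
      simp only [hs1, hs2, ha]
      omega
    · rintro ⟨s, rfl⟩
      refine ⟨_, hlin.restrict_subDiag _ (hS s s), ?_⟩
      change (2 * f (h s) + b s) / 2 ∈ ({f (h s), f (h s)} : Finset ℕ)
      simp [hdiv]
  · intro s s'
    rw [← hdouble]
    constructor
    · rintro ⟨α, hα, h1, h2, h3⟩
      simp only at h1 h2 h3
      rwa [doubleRel, hα.2 _ h1 _ h2] at h3
    · intro hs
      refine ⟨_, hlin.restrict_subDiag _ (hS s s'), ?_, ?_, hs⟩ <;>
        simp [LinDiag.IsStrictLin.restrict, hdiv]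
  · intro s s'
    rw [← hdouble]
    constructor
    · rintro ⟨α, hα, h1, h2, h3⟩
      simp only at h1 h2 h3
      rwa [doubleRel, hα.2 _ h1 _ h2] at h3
    · intro hs
      refine ⟨_, hlin.restrict_subDiag _ (hS s s'), ?_, ?_, hs⟩ <;>
        simp [LinDiag.IsStrictLin.restrict, hdiv]

theorem omega_mul_lt_double_iff {m : ℕ} (hm : 0 < m) (i i' p p' : ℕ) :
    (i < i' ∨ i = i' ∧ p < p') ↔
      i / m < i' / m ∨ i / m = i' / m ∧ (i % m < i' % m ∨ i % m = i' % m ∧ p < p') := by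
  have h1 := Nat.div_add_mod i m
  have h2 := Nat.div_add_mod i' m
  have h3 := Nat.mod_lt i hm
  have h4 := Nat.mod_lt i' hm
  rcases lt_trichotomy (i / m) (i' / m) with h | h | h
  · have : m * (i / m) + m ≤ m * (i' / m) := by
      rw [← Nat.mul_succ]; exact Nat.mul_le_mul_left m h
    have : i < i' := by omega
    simp [h, this]
  · rw [h] at h1
    simp only [h, lt_irrefl, false_or, true_and]
    omega
  · have : m * (i' / m) + m ≤ m * (i / m) := by
      rw [← Nat.mul_succ]; exact Nat.mul_le_mul_left m h
    have : i' < i := by omega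
    simp only [h.not_gt, h.ne', false_and, or_false, iff_false]
    omega

theorem pairLE_double {m M : ℕ} (hm : 0 < m) (hM : M = 2 * m) :
    PairLE (Lex (Fin m × ℕ)) ((Lex (Fin m × ℕ))ᵒᵈ) (Lex (Fin M × ℕ)) ((Lex (Fin M × ℕ))ᵒᵈ) := by
  let b : Lex (Fin M × ℕ) → ℕ := fun s => ((ofLex s).1 : ℕ) / m
  let h : Lex (Fin M × ℕ) → Lex (Fin m × ℕ) := fun s =>
    toLex (⟨((ofLex s).1 : ℕ) % m, Nat.mod_lt _ hm⟩, (ofLex s).2)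
  have hb (s) : b s < 2 := by
    have := (ofLex s).1.2
    exact (Nat.div_lt_iff_lt_mul hm).2 (by omega)
  have hsurj : ∀ i < 2, ∀ a, ∃ s, b s = i ∧ h s = a := by
    intro i hi a
    have ha := (ofLex a).1.2
    have hlt : m * i + ((ofLex a).1 : ℕ) < M := by
      have : m * i ≤ m * 1 := Nat.mul_le_mul_left m (by omega)
      omega
    refine ⟨toLex (⟨m * i + ((ofLex a).1 : ℕ), hlt⟩, (ofLex a).2), ?_, ?_⟩
    · simp [b, Nat.mul_add_div hm, Nat.div_eq_of_lt ha]
    · simp [h, Nat.mod_eq_of_lt ha]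
  have hlt (s s') : s < s' ↔ b s < b s' ∨ b s = b s' ∧ h s < h s' := by
    simp only [Prod.Lex.lt_iff, b, h, ofLex_toLex, Fin.lt_def, Fin.ext_iff]
    exact omega_mul_lt_double_iff hm _ _ _ _
  refine ⟨doubleOp, fun L hL => doubleOp_outCopy hL b h hb hsurj hlt, fun L hL =>
    doubleOp_outCopy hL (fun s => 1 - b (OrderDual.ofDual s))
      (fun s => OrderDual.toDual (h (OrderDual.ofDual s))) (fun s => by omega) ?_ ?_⟩
  · intro i hi a
    obtain ⟨s, h1, h2⟩ := hsurj (1 - i) (by omega) (OrderDual.ofDual a)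
    exact ⟨OrderDual.toDual s, by simp only [OrderDual.ofDual_toDual, h1]; omega,
      congrArg OrderDual.toDual h2⟩
  · intro s s'
    have h1 := hb (OrderDual.ofDual s)
    have h2 := hb (OrderDual.ofDual s')
    rw [← OrderDual.ofDual_lt_ofDual, hlt, OrderDual.toDual_lt_toDual]
    refine or_congr (by omega) (and_congr_left fun _ => by omega)

/-! ### Recognising copies of `ω · n` -/

theorem isCopy_of_key {n : ℕ} {L : LinDiag} (comp : ℕ → Fin n) (key : ℕ → ℕ)
    (hinj : ∀ u ∈ L.dom, ∀ v ∈ L.dom, comp u = comp v → key u = key v → u = v)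
    (hinf : ∀ i, {u | u ∈ L.dom ∧ comp u = i}.Infinite)
    (hrel : ∀ u ∈ L.dom, ∀ v ∈ L.dom,
      (L.rel u v ↔ comp u < comp v ∨ comp u = comp v ∧ key u < key v)) :
    IsCopy (Lex (Fin n × ℕ)) L := by
  let P : Fin n → ℕ → Prop := fun i q => ∃ u ∈ L.dom, comp u = i ∧ key u = q
  have hP (i : Fin n) : {q | P i q}.Infinite := by
    have : {q | P i q} = key '' {u | u ∈ L.dom ∧ comp u = i} := by
      ext q
      simp only [P, Set.mem_ofPred_eq, Set.mem_image, and_assoc]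
    rw [this]
    refine (hinf i).image ?_
    rintro u ⟨hu, rfl⟩ v ⟨hv, hvu⟩ huv
    exact hinj u hu v hv hvu.symm huv
  have hnth (i : Fin n) (p : ℕ) : P i (Nat.nth (P i) p) := Nat.nth_mem_of_infinite (hP i) p
  choose f hfd hfc hfk using hnth
  have hlt (a b : Lex (Fin n × ℕ)) :
      L.rel (f (ofLex a).1 (ofLex a).2) (f (ofLex b).1 (ofLex b).2) ↔ a < b := by
    rw [hrel _ (hfd _ _) _ (hfd _ _), hfc, hfc, hfk, hfk, Prod.Lex.lt_iff]
    refine or_congr_right (and_congr_right fun h => ?_)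
    rw [h]
    exact Nat.nth_lt_nth (hP _)
  refine ⟨fun a => f (ofLex a).1 (ofLex a).2, ?_, ?_, hlt⟩
  · intro a b hab
    simp only at hab
    by_contra hne
    have hirr : ¬ L.rel (f (ofLex a).1 (ofLex a).2) (f (ofLex a).1 (ofLex a).2) := by
      simp [hlt]
    rcases lt_or_gt_of_ne hne with hl | hl <;> rw [← hlt, hab] at hl <;>
      rw [hab] at hirr <;> exact hirr hl
  · ext u
    constructor
    · rintro ⟨a, rfl⟩
      exact hfd _ _
    · intro hu
      obtain ⟨p, hp⟩ : ∃ p, Nat.nth (P (comp u)) p = key u := by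
        have : key u ∈ Set.range (Nat.nth (P (comp u))) := by
          rw [Nat.range_nth_of_infinite (hP _)]
          exact ⟨u, hu, rfl, rfl⟩
        exact this
      refine ⟨toLex (comp u, p), ?_⟩
      exact hinj _ (hfd _ _) _ hu (hfc _ _) ((hfk _ _).trans hp)

/-- The reversed diagram. -/
def LinDiag.swap (L : LinDiag) : LinDiag where
  dom := L.dom
  rel x y := L.rel y x

theorem IsCopy.swap {τ : Type} [LinearOrder τ] {L : LinDiag} (h : IsCopy τ L) :
    IsCopy τᵒᵈ L.swap := by
  obtain ⟨f, hf, hr, hrel⟩ := h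
  exact ⟨fun a => f (OrderDual.ofDual a), fun a b hab => hf hab, hr,
    fun a b => hrel (OrderDual.ofDual b) (OrderDual.ofDual a)⟩

/-- The diagram of an order copied along `f`. -/
def LinDiag.ofFun {τ : Type} [LinearOrder τ] (f : τ → ℕ) : LinDiag where
  dom := Set.range f
  rel x y := ∃ a b, f a = x ∧ f b = y ∧ a < b

theorem isCopy_ofFun {τ : Type} [LinearOrder τ] {f : τ → ℕ} (hf : Function.Injective f) :
    IsCopy τ (LinDiag.ofFun f) := by
  refine ⟨f, hf, rfl, fun i j => ⟨?_, fun h => ⟨i, j, rfl, rfl, h⟩⟩⟩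
  rintro ⟨a, b, ha, hb, hab⟩
  rwa [← hf ha, ← hf hb]

/-! ### Positions in finite orders -/

open Classical in
/-- The position of `u` in a finite order: the number of elements below it. -/
noncomputable def FinLO.rank (α : FinLO) (u : ℕ) : ℕ :=
  (α.dom.filter fun w => α.rel w u).card

theorem FinLO.rank_lt_card (α : FinLO) {u : ℕ} (hu : u ∈ α.dom) : α.rank u < α.dom.card := by
  classical
  refine Finset.card_lt_card ⟨Finset.filter_subset _ _, fun h => ?_⟩
  exact α.irrefl u hu (Finset.mem_filter.1 (h hu)).2

theorem FinLO.rank_lt_of_rel (α : FinLO) {u v : ℕ} (hu : u ∈ α.dom) (hv : v ∈ α.dom)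
    (h : α.rel u v) : α.rank u < α.rank v := by
  classical
  refine Finset.card_lt_card ⟨fun w hw => ?_, fun hsub => ?_⟩
  · rw [Finset.mem_filter] at hw ⊢
    exact ⟨hw.1, α.trans w hw.1 u hu v hv hw.2 h⟩
  · exact α.irrefl u hu (Finset.mem_filter.1 (hsub (Finset.mem_filter.2 ⟨hu, h⟩))).2

theorem FinLO.rel_iff_rank_lt (α : FinLO) {u v : ℕ} (hu : u ∈ α.dom) (hv : v ∈ α.dom) :
    α.rel u v ↔ α.rank u < α.rank v := by
  refine ⟨α.rank_lt_of_rel hu hv, fun h => ?_⟩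
  have hne : u ≠ v := by rintro rfl; exact lt_irrefl _ h
  exact (α.total u hu v hv hne).resolve_right fun h' =>
    lt_asymm h (α.rank_lt_of_rel hv hu h')

theorem FinLO.eq_of_rank_eq (α : FinLO) {u v : ℕ} (hu : u ∈ α.dom) (hv : v ∈ α.dom)
    (h : α.rank u = α.rank v) : u = v := by
  by_contra hne
  rcases α.total u hu v hv hne with hr | hr
  · exact (α.rank_lt_of_rel hu hv hr).ne h
  · exact h.not_gt (α.rank_lt_of_rel hv hu hr)

/-- The reversed finite order. -/
def FinLO.swap (α : FinLO) : FinLO where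
  dom := α.dom
  rel x y := α.rel y x
  irrefl := α.irrefl
  trans x hx y hy z hz h h' := α.trans z hz y hy x hx h' h
  total x hx y hy hne := (α.total x hx y hy hne).symm

/-! ### Putting a copy of `ω · n` on top of a finite order -/

/-- The sum of `α` and a copy of `ω · n` on odd labels. -/
def FinLO.addTop (n : ℕ) [NeZero n] (α : FinLO) : LinDiag where
  dom := ↑α.dom ∪ {u | u % 2 = 1}
  rel u v :=
    (u % 2 = 0 ∧ v % 2 = 0 ∧ α.rel u v) ∨ (u % 2 = 0 ∧ v % 2 = 1) ∨
      (u % 2 = 1 ∧ v % 2 = 1 ∧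
        (Fin.ofNat n (u / 2).unpair.1 < Fin.ofNat n (v / 2).unpair.1 ∨
          Fin.ofNat n (u / 2).unpair.1 = Fin.ofNat n (v / 2).unpair.1 ∧ u < v))

theorem infinite_setOf_ofNat_eq {n : ℕ} [NeZero n] (i : Fin n) :
    {c : ℕ | Fin.ofNat n c = i}.Infinite := by
  refine Set.infinite_of_injective_forall_mem (f := fun q : ℕ => (i : ℕ) + n * q) ?_ ?_
  · intro q q' h
    simpa [NeZero.ne n] using h
  · intro q
    ext
    simp [Nat.mod_eq_of_lt i.2]

theorem FinLO.isCopy_addTop {n : ℕ} [NeZero n] {α : FinLO} (hα : ∀ u ∈ α.dom, u % 2 = 0) :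
    IsCopy (Lex (Fin n × ℕ)) (α.addTop n) := by
  refine isCopy_of_key
    (fun u => if u % 2 = 0 then 0 else Fin.ofNat n (u / 2).unpair.1)
    (fun u => if u % 2 = 0 then α.rank u else α.dom.card + u) ?_ ?_ ?_
  · rintro u (hu | hu) v (hv | hv) - h
    · simp only [hα u hu, hα v hv, if_true] at h
      exact α.eq_of_rank_eq hu hv h
    · have := α.rank_lt_card hu
      simp only [hα u hu, if_true, Set.mem_ofPred.1 hv, one_ne_zero, if_false] at h
      omega
    · have := α.rank_lt_card hv
      simp only [hα v hv, if_true, Set.mem_ofPred.1 hu, one_ne_zero, if_false] at h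
      omega
    · simpa [Set.mem_ofPred.1 hu, Set.mem_ofPred.1 hv] using h
  · intro i
    refine Set.infinite_of_injective_forall_mem
      (f := fun q : ℕ => 2 * Nat.pair (i : ℕ) q + 1) ?_ ?_
    · intro q q' h
      simpa [Nat.pair_eq_pair] using h
    · intro q
      refine ⟨Or.inr ?_, ?_⟩
      · simp [Nat.add_mod]
      · have h1 : (2 * Nat.pair (i : ℕ) q + 1) % 2 = 1 := by omega
        have h2 : (2 * Nat.pair (i : ℕ) q + 1) / 2 = Nat.pair (i : ℕ) q := by omega
        simp only [h1, h2, one_ne_zero, if_false, Nat.unpair_pair]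
        exact Fin.ext (Nat.mod_eq_of_lt i.2)
  · rintro u (hu | hu) v (hv | hv)
    · simp [FinLO.addTop, hα u hu, hα v hv, α.rel_iff_rank_lt hu hv]
    · have := α.rank_lt_card hu
      have h0 := Fin.zero_le (Fin.ofNat n (v / 2).unpair.1)
      have h1 : α.rank u < α.dom.card + v := by omega
      simpa [FinLO.addTop, hα u hu, Set.mem_ofPred.1 hv, h1] using h0.lt_or_eq
    · have := α.rank_lt_card hv
      have h1 : ¬ α.dom.card + u < α.rank v := by omega
      simp [FinLO.addTop, hα v hv, Set.mem_ofPred.1 hu, h1]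
    · simp [FinLO.addTop, Set.mem_ofPred.1 hu, Set.mem_ofPred.1 hv]

theorem FinLO.subDiag_addTop {n : ℕ} [NeZero n] {α : FinLO} (hα : ∀ u ∈ α.dom, u % 2 = 0) :
    α.SubDiag (α.addTop n) := by
  refine ⟨Set.subset_union_left, fun u hu v hv => ?_⟩
  simp [FinLO.addTop, hα u hu, hα v hv]

theorem FinLO.Ext.subDiag_addTop {n : ℕ} [NeZero n] {α β ε : FinLO} (h : α.Ext β)
    (hβ : ∀ u ∈ β.dom, u % 2 = 0) (hε : ε.SubDiag (α.addTop n)) : ε.SubDiag (β.addTop n) := by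
  refine ⟨hε.1.trans (Set.union_subset_union_left _ h.1), fun u hu v hv => ?_⟩
  rw [hε.2 u hu v hv]
  rcases hε.1 hu with hu' | hu' <;> rcases hε.1 hv with hv' | hv'
  · simp [FinLO.addTop, hβ u (h.1 hu'), hβ v (h.1 hv'), h.2 u hu' v hv']
  · simp [FinLO.addTop, Set.mem_ofPred.1 hv']
  · simp [FinLO.addTop, Set.mem_ofPred.1 hu']
  · simp [FinLO.addTop, Set.mem_ofPred.1 hu']

section Transfer

variable {Γ : EnumOp} {n : ℕ} [NeZero n] {C D : Type} [LinearOrder C] [LinearOrder D]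

/-- Finite extensions of `γ` decide pairs of elements of `Γ(γ)` as `γ + ω · n` does. -/
theorem EnumOp.pos_addTop_of_ext
    (hΓ : ∀ L, IsCopy (Lex (Fin n × ℕ)) L → Γ.OutCopy C L)
    {γ δ : FinLO} (hγδ : γ.Ext δ) (hδ : ∀ u ∈ δ.dom, u % 2 = 0) {x y : ℕ}
    (hx : x ∈ Γ.mem γ) (hy : y ∈ Γ.mem γ) :
    ((x, y) ∈ Γ.pos δ → (x, y) ∉ Γ.negD (γ.addTop n)) ∧
      ((x, y) ∈ Γ.neg δ → (x, y) ∉ Γ.posD (γ.addTop n)) := by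
  have hout := hΓ _ (FinLO.isCopy_addTop hδ)
  have hsub := FinLO.subDiag_addTop (n := n) hδ
  have hx' : x ∈ Γ.memD (δ.addTop n) := ⟨δ, hsub, Γ.mono_mem hγδ hx⟩
  have hy' : y ∈ Γ.memD (δ.addTop n) := ⟨δ, hsub, Γ.mono_mem hγδ hy⟩
  constructor
  · rintro hp ⟨ε, hε, hn⟩
    exact hout.not_pos_and_neg hx' hy' ⟨δ, hsub, hp⟩ ⟨ε, hγδ.subDiag_addTop hδ hε, hn⟩
  · rintro hn ⟨ε, hε, hp⟩
    exact hout.not_pos_and_neg hx' hy' ⟨ε, hγδ.subDiag_addTop hδ hε, hp⟩ ⟨δ, hsub, hn⟩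

/-- The output order of two elements enumerated by a common finite part `γ` of `L` and `M` is
the same in both outputs. -/
theorem EnumOp.posD_transfer
    (hΓ : ∀ L, IsCopy (Lex (Fin n × ℕ)) L → Γ.OutCopy C L)
    {L M : LinDiag} (hL : L.IsStrictLin) (hM : M.IsStrictLin)
    (hLe : ∀ u ∈ L.dom, u % 2 = 0) (hMe : ∀ u ∈ M.dom, u % 2 = 0)
    (hMout : Γ.OutCopy D M) {γ : FinLO} (hγL : γ.SubDiag L) (hγM : γ.SubDiag M) {x y : ℕ}
    (hx : x ∈ Γ.mem γ) (hy : y ∈ Γ.mem γ) (h : (x, y) ∈ Γ.posD L) : (x, y) ∈ Γ.posD M := by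
  have hγe : ∀ u ∈ γ.dom, u % 2 = 0 := fun u hu => hLe u (hγL.1 hu)
  have htop := FinLO.subDiag_addTop (n := n) hγe
  have hpos : (x, y) ∈ Γ.posD (γ.addTop n) := by
    obtain ⟨α, hα, hp⟩ := h
    obtain ⟨δ, hδ, h1, h2⟩ := FinLO.SubDiag.exists_common_ext hL hα hγL
    refine ((hΓ _ (FinLO.isCopy_addTop hγe)).pos_or_neg ⟨γ, htop, hx⟩ ⟨γ, htop, hy⟩).resolve_right
      ((EnumOp.pos_addTop_of_ext hΓ h2 (fun u hu => hLe u (hδ.1 hu)) hx hy).1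
        (Γ.mono_pos h1 hp))
  refine (hMout.pos_or_neg ⟨γ, hγM, hx⟩ ⟨γ, hγM, hy⟩).resolve_right ?_
  rintro ⟨α, hα, hn⟩
  obtain ⟨δ, hδ, h1, h2⟩ := FinLO.SubDiag.exists_common_ext hM hα hγM
  exact (EnumOp.pos_addTop_of_ext hΓ h2 (fun u hu => hMe u (hδ.1 hu)) hx hy).2
    (Γ.mono_neg h1 hn) hpos

end Transfer

/-! ### Sums of finite blocks -/

/-- The sum of the finite orders `B c`, ordered first by `comp c` and then by `c`; the label `u`
belongs to the block `B (blk u)`. -/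
def blockSum {n : ℕ} (B : ℕ → FinLO) (blk : ℕ → ℕ) (comp : ℕ → Fin n) : LinDiag where
  dom := {u | u ∈ (B (blk u)).dom}
  rel u v := comp (blk u) < comp (blk v) ∨ comp (blk u) = comp (blk v) ∧
    (blk u < blk v ∨ blk u = blk v ∧ (B (blk u)).rel u v)

theorem isCopy_blockSum {n : ℕ} {B : ℕ → FinLO} {blk : ℕ → ℕ} {comp : ℕ → Fin n}
    (hblk : ∀ c, ∀ u ∈ (B c).dom, blk u = c) (hne : ∀ c, (B c).dom.Nonempty)
    (hcomp : ∀ i, {c | comp c = i}.Infinite) :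
    IsCopy (Lex (Fin n × ℕ)) (blockSum B blk comp) := by
  let off : ℕ → ℕ := fun c => ∑ d ∈ Finset.range c, (B d).dom.card
  have hoff : Monotone off := fun c d h =>
    Finset.sum_le_sum_of_subset (Finset.range_mono h)
  let key : ℕ → ℕ := fun u => off (blk u) + (B (blk u)).rank u
  have hkey {u v : ℕ} (hu : u ∈ (B (blk u)).dom) (h : blk u < blk v) : key u < key v := by
    have h1 : off (blk u + 1) ≤ off (blk v) := hoff h
    have h2 : off (blk u + 1) = off (blk u) + (B (blk u)).dom.card :=
      Finset.sum_range_succ _ _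
    have h3 := (B (blk u)).rank_lt_card hu
    simp only [key]
    omega
  refine isCopy_of_key (fun u => comp (blk u)) key ?_ ?_ ?_
  · intro u hu v hv _ h
    rcases lt_trichotomy (blk u) (blk v) with hl | hl | hl
    · exact absurd h (hkey hu hl).ne
    · refine (B (blk u)).eq_of_rank_eq hu (hl ▸ hv) ?_
      simp only [key, ← hl] at h
      omega
    · exact absurd h (hkey hv hl).ne'
  · intro i
    choose e he using hne
    refine ((hcomp i).image (f := e) fun c _ d _ h => ?_).mono ?_
    · rw [← hblk c _ (he c), ← hblk d _ (he d), h]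
    · rintro _ ⟨c, hc, rfl⟩
      have := hblk c _ (he c)
      exact ⟨by simp [blockSum, this, he], by simpa [this] using hc⟩
  · intro u hu v hv
    refine or_congr_right (and_congr_right fun _ => ?_)
    rcases lt_trichotomy (blk u) (blk v) with hl | hl | hl
    · simp [hl, hkey hu hl]
    · rw [(B (blk u)).rel_iff_rank_lt hu (hl ▸ hv)]
      simp [key, ← hl]
    · simp [hl.not_gt, hl.ne', (hkey hv hl).le]

/-- An operator producing infinite outputs on copies of `ω · n` admits, for every `c`, a nonempty
finite order with labels coded by `c` whose output contains a number exceeding `c`. -/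
theorem EnumOp.exists_block {Γ : EnumOp} {n : ℕ} [NeZero n] {C : Type} [LinearOrder C]
    [Infinite C] (hΓ : ∀ L, IsCopy (Lex (Fin n × ℕ)) L → Γ.OutCopy C L) (c : ℕ) :
    ∃ α : FinLO, ∃ x : ℕ, α.dom.Nonempty ∧
      (∀ u ∈ α.dom, u % 2 = 0 ∧ (u / 2).unpair.1 = c) ∧ x ∈ Γ.mem α ∧ c < x := by
  let f : Lex (Fin n × ℕ) → ℕ := fun a =>
    2 * Nat.pair c (Nat.pair ((ofLex a).1 : ℕ) (ofLex a).2)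
  have hf : Function.Injective f := by
    intro a b h
    simp only [f, mul_eq_mul_left_iff, Nat.pair_eq_pair, true_and, OfNat.ofNat_ne_zero,
      or_false] at h
    exact ofLex.injective (Prod.ext (Fin.ext h.1) h.2)
  have hcopy := isCopy_ofFun hf
  have hlin := hcopy.isStrictLin
  obtain ⟨g, hg, hmem, -⟩ := hΓ _ hcopy
  have hinf : (Γ.memD (LinDiag.ofFun f)).Infinite := by
    rw [hmem]
    exact Set.infinite_range_of_injective hg
  obtain ⟨x, ⟨α, hα, hx⟩, hcx⟩ := hinf.exists_gt c
  have hS : ((insert (f (toLex (0, 0))) α.dom : Finset ℕ) : Set ℕ) ⊆ (LinDiag.ofFun f).dom := by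
    rw [Finset.coe_insert]
    exact Set.insert_subset ⟨_, rfl⟩ hα.1
  refine ⟨hlin.restrict _ hS, x, Finset.insert_nonempty _ _, fun u hu => ?_,
    Γ.mono_mem (hα.ext_restrict hlin _ hS (Finset.subset_insert _ _)) hx, hcx⟩
  obtain ⟨a, rfl⟩ := hS hu
  simp [f]

/-- An infinite family of elements of `ω · t` is unbounded in one of the components. -/
theorem exists_unbounded_component {t : ℕ} {g : Lex (Fin t × ℕ) → ℕ} {S : Set ℕ}
    (hS : S.Infinite) (hg : S ⊆ Set.range g) :
    ∃ j : Fin t, ∀ N, ∃ p, N < p ∧ g (toLex (j, p)) ∈ S := by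
  by_contra! h
  choose N hN using h
  refine hS (Set.Finite.subset (Set.Finite.image (fun a : Fin t × ℕ => g (toLex a))
    (s := Set.univ ×ˢ Set.Iic (Finset.univ.sup N))
    (Set.finite_univ.prod (Set.finite_Iic _))) ?_)
  intro x hx
  obtain ⟨a, rfl⟩ := hg hx
  refine ⟨ofLex a, ⟨trivial, ?_⟩, rfl⟩
  by_contra hlt
  refine hN (ofLex a).1 (ofLex a).2 ?_ hx
  exact (Finset.le_sup (f := N) (Finset.mem_univ _)).trans_lt (not_le.1 hlt)

/-- Distinct components of a copy of `ω · n` need distinct components of `ω · t` for their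
outputs. -/
theorem le_of_pairLE {n t : ℕ} [NeZero n] [NeZero t]
    (h : PairLE (Lex (Fin n × ℕ)) ((Lex (Fin n × ℕ))ᵒᵈ)
      (Lex (Fin t × ℕ)) ((Lex (Fin t × ℕ))ᵒᵈ)) : n ≤ t := by
  obtain ⟨Γ, hΓ, hΓ'⟩ := h
  have : Infinite (Lex (Fin t × ℕ)) :=
    Infinite.of_injective (fun p : ℕ => toLex ((0 : Fin t), p))
      fun p q h => (Prod.ext_iff.1 (toLex.injective h)).2
  choose B x hne hlab hx hcx using EnumOp.exists_block (Γ := Γ) hΓ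
  let blk : ℕ → ℕ := fun u => (u / 2).unpair.1
  let comp : ℕ → Fin n := Fin.ofNat n
  have hblk : ∀ c, ∀ u ∈ (B c).dom, blk u = c := fun c u hu => (hlab c u hu).2
  let L := blockSum B blk comp
  let M := (blockSum (fun c => (B c).swap) blk fun c => (comp c).rev).swap
  have hL : IsCopy (Lex (Fin n × ℕ)) L := isCopy_blockSum hblk hne infinite_setOf_ofNat_eq
  have hM : IsCopy ((Lex (Fin n × ℕ))ᵒᵈ) M := by
    refine (isCopy_blockSum (B := fun c => (B c).swap) (comp := fun c => (comp c).rev) hblk hne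
      fun i => ?_).swap
    simpa only [Fin.rev_eq_iff] using infinite_setOf_ofNat_eq i.rev
  have heven : ∀ u ∈ L.dom, u % 2 = 0 := fun u hu => (hlab _ u hu).1
  have hmemL (c u) (hu : u ∈ (B c).dom) : u ∈ L.dom := by
    have := hblk c u hu
    simpa [L, blockSum, this] using hu
  have hBL (c : ℕ) : (B c).SubDiag L := by
    refine ⟨hmemL c, fun u hu v hv => ?_⟩
    simp [L, blockSum, hblk c u hu, hblk c v hv]
  have hBM (c : ℕ) : (B c).SubDiag M := by
    refine ⟨hmemL c, fun u hu v hv => ?_⟩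
    simp [M, blockSum, LinDiag.swap, FinLO.swap, hblk c u hu, hblk c v hv]
  obtain ⟨g, -, hmem, hpos, -⟩ := hΓ L hL
  have hMout := hΓ' M hM
  have htransfer (c d : ℕ) (hcd : comp c ≠ comp d) (h : (x c, x d) ∈ Γ.posD L) :
      (x c, x d) ∈ Γ.posD M := by
    have hS : (((B c).dom ∪ (B d).dom : Finset ℕ) : Set ℕ) ⊆ L.dom := by
      simpa using ⟨(hBL c).1, (hBL d).1⟩
    have hlin := hL.isStrictLin
    refine EnumOp.posD_transfer hΓ hlin hM.isStrictLin heven heven hMout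
      (hlin.restrict_subDiag _ hS) ⟨hS, fun u hu v hv => ?_⟩
      (Γ.mono_mem ((hBL c).ext_restrict hlin _ hS Finset.subset_union_left) (hx c))
      (Γ.mono_mem ((hBL d).ext_restrict hlin _ hS Finset.subset_union_right) (hx d)) h
    change L.rel u v ↔ M.rel u v
    rcases Finset.mem_union.1 hu with hu | hu <;> rcases Finset.mem_union.1 hv with hv | hv
    · rw [← (hBL c).2 u hu v hv, (hBM c).2 u hu v hv]
    · simp [L, M, blockSum, LinDiag.swap, hblk c u hu, hblk d v hv, hcd, hcd.symm]
    · simp [L, M, blockSum, LinDiag.swap, hblk d u hu, hblk c v hv, hcd, hcd.symm]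
    · rw [← (hBL d).2 u hu v hv, (hBM d).2 u hu v hv]
  have hcol (i : Fin n) : ∃ j : Fin t, ∀ N, ∃ p, N < p ∧
      g (toLex (j, p)) ∈ x '' {c | comp c = i} := by
    refine exists_unbounded_component ?_ ?_
    · refine Set.infinite_of_not_bddAbove fun ⟨N, hN⟩ => ?_
      obtain ⟨c, hc, hNc⟩ := (infinite_setOf_ofNat_eq i).exists_gt N
      exact absurd (hN ⟨c, hc, rfl⟩) (not_le.2 (hNc.trans (hcx c)))
    · rintro _ ⟨c, -, rfl⟩
      rw [← hmem]
      exact ⟨B c, hBL c, hx c⟩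
  choose col hcol using hcol
  by_contra! hlt
  obtain ⟨i, i', hii, hcc⟩ : ∃ i i', i ≠ i' ∧ col i = col i' :=
    Fintype.exists_ne_map_eq_of_card_lt col (by simpa using hlt)
  obtain ⟨g', hg', hmem', hpos', -⟩ := hMout
  have hxM (c : ℕ) : ∃ b, g' b = x c := by
    have : x c ∈ Γ.memD M := ⟨B c, hBM c, hx c⟩
    rwa [hmem'] at this
  have step (i i' : Fin n) (hii : i ≠ i') (hcc : col i = col i') (c p b)
      (hc : comp c = i) (hp : x c = g (toLex (col i, p))) (hb : g' b = x c) :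
      ∃ c' p' b', comp c' = i' ∧ x c' = g (toLex (col i', p')) ∧ g' b' = x c' ∧ b < b' := by
    obtain ⟨p', hpp, c', hc', hp'⟩ := hcol i' p
    obtain ⟨b', hb'⟩ := hxM c'
    refine ⟨c', p', b', hc', hp', hb', ?_⟩
    rw [← hpos', hb, hb']
    refine htransfer c c' (by rw [hc, hc']; exact hii) ?_
    rw [hp, hp', hpos, hcc]
    simpa [Prod.Lex.lt_iff] using hpp
  let S : Set ((Lex (Fin t × ℕ))ᵒᵈ) :=
    {b | ∃ c p, comp c = i ∧ x c = g (toLex (col i, p)) ∧ g' b = x c}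
  have hSne : S.Nonempty := by
    obtain ⟨p, -, c, hc, hp⟩ := hcol i 0
    obtain ⟨b, hb⟩ := hxM c
    exact ⟨b, c, p, hc, hp, hb⟩
  obtain ⟨b, ⟨c, p, hc, hp, hb⟩, hmax⟩ :=
    (wellFounded_gt (α := (Lex (Fin t × ℕ))ᵒᵈ)).has_min S hSne
  obtain ⟨c', p', b', hc', hp', hb', hbb⟩ := step i i' hii hcc c p b hc hp hb
  obtain ⟨c₂, p₂, b₂, hc₂, hp₂, hb₂, hbb₂⟩ :=
    step i' i hii.symm hcc.symm c' p' b' hc' hp' hb'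
  exact hmax b₂ ⟨c₂, p₂, hc₂, hp₂, hb₂⟩ (hbb.trans hbb₂)

/-- for every `k`, `{ω·2^k, ω*·2^k} <_c {ω·2^(k+1), ω*·2^(k+1)}`. -/
theorem strict_chain (k : ℕ) :
    PairLE (Lex (Fin (2 ^ k) × ℕ)) ((Lex (Fin (2 ^ k) × ℕ))ᵒᵈ)
      (Lex (Fin (2 ^ (k + 1)) × ℕ)) ((Lex (Fin (2 ^ (k + 1)) × ℕ))ᵒᵈ) ∧
    ¬ PairLE (Lex (Fin (2 ^ (k + 1)) × ℕ)) ((Lex (Fin (2 ^ (k + 1)) × ℕ))ᵒᵈ)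
      (Lex (Fin (2 ^ k) × ℕ)) ((Lex (Fin (2 ^ k) × ℕ))ᵒᵈ) := by
  refine ⟨pairLE_double (by positivity) (pow_succ' 2 k), fun h => ?_⟩
  exact absurd (le_of_pairLE h) (not_le.2 (Nat.pow_lt_pow_right one_lt_two k.lt_succ_self))
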